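/- arXiv:1907.09857 — 3 statements merged into one kernel-verified Lean document; each statement's English description precedes it below -/
import Mathlib

section
/- Let λ⁺, λ⁻ > 0 be arbitrary. Then the bilateral Gamma distributions Γ( (λ⁺)²λ⁻n/(λ⁺+λ⁻), λ⁺√n ; λ⁺(λ⁻)²n/(λ⁺+λ⁻), λ⁻√n ) converge weakly, as n → ∞, to the standard normal distribution N(0,1). -/
open MeasureTheory ProbabilityTheory Filter

/-- The bilateral Gamma distribution `Γ(α⁺,λ⁺;α⁻,λ⁻)`: the law of `X − Y` for independent
`X ~ Γ(α⁺,λ⁺)`, `Y ~ Γ(α⁻,λ⁻)`. -/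
noncomputable def bilateralGammaMeasure (ap lp am lm : ℝ) : Measure ℝ :=
  ((gammaMeasure ap lp).prod (gammaMeasure am lm)).map (fun p => p.1 - p.2)

open scoped Topology

lemma mgf_gammaMeasure {a r x : ℝ} (ha : 0 < a) (hr : 0 < r) (hx : x < r) :
    mgf id (gammaMeasure a r) x = (1 - x / r) ^ (-a) := by
  have hrx : 0 < r - x := sub_pos.2 hx
  have := (Real.Gamma_pos_of_pos ha).ne'
  have hpdf : ∀ y, (gammaPDF a r y).toReal • Real.exp (x * id y) =
      (Set.Ici (0 : ℝ)).indicator (fun y ↦ r ^ a / Real.Gamma a *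
        (y ^ (a - 1) * Real.exp (-((r - x) * y)))) y := by
    intro y
    rw [gammaPDF, ENNReal.toReal_ofReal (gammaPDFReal_nonneg ha hr y), gammaPDFReal,
      Set.indicator_apply]
    by_cases hy : 0 ≤ y
    · rw [if_pos hy, if_pos (Set.mem_Ici.2 hy), smul_eq_mul, mul_assoc, mul_assoc, ← Real.exp_add]
      congr 3
      simp only [id]
      ring
    · simp [hy]
  rw [mgf, gammaMeasure, integral_withDensity_eq_integral_toReal_smul (f := gammaPDF a r)
    (measurable_gammaPDFReal a r).ennreal_ofReal (ae_of_all _ fun _ ↦ ENNReal.ofReal_lt_top)]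
  simp_rw [hpdf]
  rw [integral_indicator measurableSet_Ici, integral_Ici_eq_integral_Ioi, integral_const_mul,
    Real.integral_rpow_mul_exp_neg_mul_Ioi ha hrx]
  have h1 : 1 - x / r = (r - x) / r := by field_simp
  rw [h1, Real.rpow_neg (by positivity), Real.div_rpow hrx.le hr.le,
    Real.div_rpow zero_le_one hrx.le, Real.one_rpow]
  have := (Real.rpow_pos_of_pos hrx a).ne'
  have := (Real.rpow_pos_of_pos hr a).ne'
  field_simp

lemma Iio_subset_integrableExpSet_gammaMeasure {a r : ℝ} (ha : 0 < a) (hr : 0 < r) :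
    Set.Iio r ⊆ integrableExpSet id (gammaMeasure a r) := by
  intro x hx
  by_contra h
  have h0 := mgf_gammaMeasure ha hr hx
  rw [mgf_undef h] at h0
  have : 0 < 1 - x / r := sub_pos.2 ((div_lt_one hr).2 hx)
  exact (Real.rpow_pos_of_pos this (-a)).ne h0

lemma complexMGF_gammaMeasure {a r : ℝ} (ha : 0 < a) (hr : 0 < r) {z : ℂ} (hz : z.re < r) :
    complexMGF id (gammaMeasure a r) z = Complex.exp (-a * Complex.log (1 - z / r)) := by
  have hpos {x : ℝ} (hx : x < r) : 0 < 1 - x / r := sub_pos.2 ((div_lt_one hr).2 hx)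
  have hslit {w : ℂ} (hw : w.re < r) : 1 - w / r ∈ Complex.slitPlane := by
    left
    simpa using hpos hw
  have hf : AnalyticOnNhd ℂ (complexMGF id (gammaMeasure a r)) {z | z.re < r} := fun w hw ↦
    analyticAt_complexMGF <|
      interior_mono (Iio_subset_integrableExpSet_gammaMeasure ha hr) (by simpa using hw)
  have hg : AnalyticOnNhd ℂ (fun z : ℂ ↦ Complex.exp (-a * Complex.log (1 - z / r)))
      {z | z.re < r} := by
    refine DifferentiableOn.analyticOnNhd (fun w hw ↦ ?_)
      (isOpen_Iio.preimage Complex.continuous_re)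
    have : DifferentiableAt ℂ (fun z : ℂ ↦ 1 - z / r) w := by fun_prop
    exact (((this.clog (hslit hw)).const_mul _).cexp).differentiableWithinAt
  have hreal {x : ℝ} (hx : x < r) : complexMGF id (gammaMeasure a r) x =
      Complex.exp (-a * Complex.log (1 - x / r)) := by
    rw [complexMGF_ofReal, mgf_gammaMeasure ha hr hx, Real.rpow_def_of_pos (hpos hx)]
    push_cast [Complex.ofReal_log (hpos hx).le]
    ring_nf
  refine hf.eqOn_of_preconnected_of_frequently_eq hg (convex_halfSpace_re_lt r).isPreconnected
    (z₀ := ((0 : ℝ) : ℂ)) (by simpa using hr) ?_ hz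
  have hfreq : ∃ᶠ x : ℝ in 𝓝[≠] 0, x < r :=
    ((eventually_lt_nhds hr).filter_mono nhdsWithin_le_nhds).frequently
  have htend : Tendsto (fun x : ℝ ↦ (x : ℂ)) (𝓝[≠] 0) (𝓝[≠] ((0 : ℝ) : ℂ)) :=
    tendsto_nhdsWithin_of_tendsto_nhds_of_eventually_within _
      (Complex.continuous_ofReal.continuousAt.tendsto.mono_left nhdsWithin_le_nhds)
      (by filter_upwards [self_mem_nhdsWithin] with x hx; simpa using hx)
  exact htend.frequently (hfreq.mono fun x hx ↦ hreal hx)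

lemma charFun_gammaMeasure {a r : ℝ} (ha : 0 < a) (hr : 0 < r) (t : ℝ) :
    charFun (gammaMeasure a r) t = Complex.exp (-a * Complex.log (1 - t * Complex.I / r)) := by
  rw [← complexMGF_id_mul_I, complexMGF_gammaMeasure ha hr (by simpa using hr)]

lemma isProbabilityMeasure_bilateralGammaMeasure {ap lp am lm : ℝ}
    (hap : 0 < ap) (hlp : 0 < lp) (ham : 0 < am) (hlm : 0 < lm) :
    IsProbabilityMeasure (bilateralGammaMeasure ap lp am lm) := by
  have := isProbabilityMeasure_gammaMeasure hap hlp
  have := isProbabilityMeasure_gammaMeasure ham hlm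
  exact Measure.isProbabilityMeasure_map (by fun_prop)

lemma charFun_bilateralGammaMeasure {ap lp am lm : ℝ}
    (hap : 0 < ap) (hlp : 0 < lp) (ham : 0 < am) (hlm : 0 < lm) (t : ℝ) :
    charFun (bilateralGammaMeasure ap lp am lm) t =
      Complex.exp (-ap * Complex.log (1 - t * Complex.I / lp)
        - am * Complex.log (1 + t * Complex.I / lm)) := by
  have := isProbabilityMeasure_gammaMeasure hap hlp
  have := isProbabilityMeasure_gammaMeasure ham hlm
  have hsplit (p : ℝ × ℝ) : Complex.exp (t * ((p.1 - p.2 : ℝ) : ℂ) * Complex.I) =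
      Complex.exp (t * p.1 * Complex.I) * Complex.exp ((-t : ℝ) * p.2 * Complex.I) := by
    rw [← Complex.exp_add]
    push_cast
    ring_nf
  rw [charFun_apply_real, bilateralGammaMeasure, integral_map (by fun_prop) (by fun_prop)]
  simp_rw [hsplit]
  rw [integral_prod_mul (fun x : ℝ ↦ Complex.exp (t * x * Complex.I))
      (fun y : ℝ ↦ Complex.exp ((-t : ℝ) * y * Complex.I)),
    ← charFun_apply_real, ← charFun_apply_real, charFun_gammaMeasure hap hlp,
    charFun_gammaMeasure ham hlm, ← Complex.exp_add]
  push_cast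
  ring_nf

lemma tendsto_natCast_mul_log_one_add_div_sqrt_sub (c : ℂ) :
    Tendsto (fun n : ℕ ↦ (n : ℂ) * (Complex.log (1 + c / (√n : ℝ))
      - (c / (√n : ℝ) - (c / (√n : ℝ)) ^ 2 / 2))) atTop (𝓝 0) := by
  have hsqrt : Tendsto (fun n : ℕ ↦ √(n : ℝ)) atTop atTop :=
    Real.tendsto_sqrt_atTop.comp tendsto_natCast_atTop_atTop
  have hinv : Tendsto (fun n : ℕ ↦ (((√(n : ℝ))⁻¹ : ℝ) : ℂ)) atTop (𝓝 0) :=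
    mod_cast (Complex.continuous_ofReal.tendsto 0).comp (tendsto_inv_atTop_zero.comp hsqrt)
  have hz : Tendsto (fun n : ℕ ↦ c / ((√(n : ℝ) : ℝ) : ℂ)) atTop (𝓝 0) := by
    simpa [div_eq_mul_inv] using hinv.const_mul c
  have hO := (Asymptotics.isBigO_refl (fun n : ℕ ↦ (n : ℂ)) atTop).mul
    ((Complex.log_sub_logTaylor_isBigO 2).comp_tendsto hz)
  have hlim : Tendsto (fun n : ℕ ↦ (n : ℂ) * (c / ((√(n : ℝ) : ℝ) : ℂ)) ^ (2 + 1))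
      atTop (𝓝 0) := by
    have h := hinv.const_mul (c ^ 3)
    rw [mul_zero] at h
    refine h.congr' ?_
    filter_upwards [eventually_gt_atTop 0] with n hn
    have hs : ((√(n : ℝ) : ℝ) : ℂ) ≠ 0 := by
      exact_mod_cast (Real.sqrt_pos.2 (Nat.cast_pos.2 hn)).ne'
    have hn' : (n : ℂ) = ((√(n : ℝ) : ℝ) : ℂ) ^ 2 := by
      exact_mod_cast (Real.sq_sqrt (Nat.cast_nonneg n)).symm
    rw [hn']
    push_cast
    field_simp
  refine (hO.trans_tendsto hlim).congr fun n ↦ ?_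
  simp only [Function.comp_apply, Complex.logTaylor_succ, Complex.logTaylor_zero, Pi.add_apply]
  push_cast
  ring

lemma tendsto_charFun_bilateralGammaMeasure {lp lm : ℝ} (hlp : 0 < lp) (hlm : 0 < lm) (t : ℝ) :
    Tendsto (fun n : ℕ ↦ charFun (bilateralGammaMeasure
        (lp ^ 2 * lm * n / (lp + lm)) (lp * √n) (lp * lm ^ 2 * n / (lp + lm)) (lm * √n)) t)
      atTop (𝓝 (charFun (gaussianReal 0 1) t)) := by
  have h1 := (tendsto_natCast_mul_log_one_add_div_sqrt_sub (-(t * Complex.I / lp))).const_mul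
    (-((lp : ℂ) ^ 2 * lm / (lp + lm)))
  have h2 := (tendsto_natCast_mul_log_one_add_div_sqrt_sub (t * Complex.I / lm)).const_mul
    ((lp : ℂ) * lm ^ 2 / (lp + lm))
  have h := ((h1.sub h2).add_const (-(t : ℂ) ^ 2 / 2)).cexp
  rw [charFun_gaussianReal]
  convert! h.congr' ?_ using 2
  · simp [neg_div]
  filter_upwards [eventually_gt_atTop 0] with n hn
  have hn0 : (0 : ℝ) < n := Nat.cast_pos.2 hn
  have hs0 : 0 < √(n : ℝ) := Real.sqrt_pos.2 hn0
  rw [charFun_bilateralGammaMeasure (by positivity) (by positivity) (by positivity)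
    (by positivity)]
  have hs : ((√(n : ℝ) : ℝ) : ℂ) ≠ 0 := by exact_mod_cast hs0.ne'
  have hp : (lp : ℂ) ≠ 0 := by exact_mod_cast hlp.ne'
  have hm : (lm : ℂ) ≠ 0 := by exact_mod_cast hlm.ne'
  have hpm : (lp : ℂ) + lm ≠ 0 := by exact_mod_cast (add_pos hlp hlm).ne'
  have hn' : (n : ℂ) = ((√(n : ℝ) : ℝ) : ℂ) ^ 2 := by
    exact_mod_cast (Real.sq_sqrt hn0.le).symm
  congr 1
  push_cast
  have e1 : 1 + -(t * Complex.I / lp) / ((√(n : ℝ) : ℝ) : ℂ) =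
      1 - t * Complex.I / (lp * ((√(n : ℝ) : ℝ) : ℂ)) := by
    field_simp
    ring
  rw [e1, div_div]
  generalize Complex.log (1 - t * Complex.I / (lp * ((√(n : ℝ) : ℝ) : ℂ))) = L₁
  generalize Complex.log (1 + t * Complex.I / (lm * ((√(n : ℝ) : ℝ) : ℂ))) = L₂
  rw [hn']
  field_simp
  ring_nf
  simp only [Complex.I_sq]
  ring

/-- for any `λ⁺, λ⁻ > 0`, the bilateral Gamma distributions
`Γ((λ⁺)²λ⁻n/(λ⁺+λ⁻), λ⁺√n; λ⁺(λ⁻)²n/(λ⁺+λ⁻), λ⁻√n)` converge weakly to `N(0,1)` as `n → ∞`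
(weak convergence being tested against all bounded continuous functions). -/
theorem bilateralGamma_tendsto_gaussian (lp lm : ℝ) (hlp : 0 < lp) (hlm : 0 < lm) :
    ∀ f : BoundedContinuousFunction ℝ ℝ,
      Tendsto
        (fun n : ℕ =>
          ∫ x, f x ∂(bilateralGammaMeasure
            (lp ^ 2 * lm * n / (lp + lm)) (lp * Real.sqrt n)
            (lp * lm ^ 2 * n / (lp + lm)) (lm * Real.sqrt n)))
        atTop (nhds (∫ x, f x ∂(gaussianReal 0 1))) := by
  intro f
  rw [← tendsto_add_atTop_iff_nat 1]
  have hprob (n : ℕ) : IsProbabilityMeasure (bilateralGammaMeasure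
      (lp ^ 2 * lm * (n + 1 : ℕ) / (lp + lm)) (lp * √(n + 1 : ℕ))
      (lp * lm ^ 2 * (n + 1 : ℕ) / (lp + lm)) (lm * √(n + 1 : ℕ))) :=
    isProbabilityMeasure_bilateralGammaMeasure (by positivity) (by positivity) (by positivity)
      (by positivity)
  let μ (n : ℕ) : ProbabilityMeasure ℝ := ⟨_, hprob n⟩
  let ν : ProbabilityMeasure ℝ := ⟨gaussianReal 0 1, inferInstance⟩
  have hμ : Tendsto μ atTop (𝓝 ν) := ProbabilityMeasure.tendsto_iff_tendsto_charFun.2 fun t ↦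
    (tendsto_add_atTop_iff_nat 1).2 (tendsto_charFun_bilateralGammaMeasure hlp hlm t)
  exact ProbabilityMeasure.tendsto_iff_forall_integral_tendsto.1 hμ f
end

section
/- Let α, λ⁺, λ⁻ > 0 and set μ := α/λ⁺ − α/λ⁻ and σ² := 2α/(λ⁺λ⁻). Then the bilateral Gamma distribution Γ(α,λ⁺;α,λ⁻) is a Normal variance-mean mixture over a Gamma mixing law: it equals the measure obtained by binding the Gamma distribution Γ(α,α) with the Gaussian kernel s ↦ N(μ·s, σ²·s), i.e. Γ(α,λ⁺;α,λ⁻) = ∫₀^∞ N(μs, σ²s) dΓ(α,α)(s). -/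
open MeasureTheory ProbabilityTheory

/-- Finite measures on `ℝ` whose moment generating functions are finite and coincide on a
neighbourhood of `0` are equal. -/
theorem MeasureTheory.Measure.ext_of_lintegral_exp_mul_eq {P Q : Measure ℝ}
    [IsFiniteMeasure P] [IsFiniteMeasure Q] {ε : ℝ} (hε : 0 < ε)
    (hfin : ∀ t ∈ Set.Ioo (-ε) ε, ∫⁻ x, ENNReal.ofReal (Real.exp (t * x)) ∂P ≠ ⊤)
    (h : ∀ t ∈ Set.Ioo (-ε) ε, ∫⁻ x, ENNReal.ofReal (Real.exp (t * x)) ∂P =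
      ∫⁻ x, ENNReal.ofReal (Real.exp (t * x)) ∂Q) : P = Q := by
  have integrable_exp (ρ : Measure ℝ) (t : ℝ)
      (ht : ∫⁻ x, ENNReal.ofReal (Real.exp (t * x)) ∂ρ ≠ ⊤) :
      Integrable (fun x ↦ Real.exp (t * id x)) ρ :=
    (lintegral_ofReal_ne_top_iff_integrable (by fun_prop)
      (ae_of_all _ fun _ ↦ Real.exp_nonneg _)).1 ht
  have subset_P : Set.Ioo (-ε) ε ⊆ interior (integrableExpSet id P) :=
    interior_maximal (fun t ht ↦ integrable_exp P t (hfin t ht)) isOpen_Ioo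
  have subset_Q : Set.Ioo (-ε) ε ⊆ interior (integrableExpSet id Q) :=
    interior_maximal (fun t ht ↦ integrable_exp Q t (h t ht ▸ hfin t ht)) isOpen_Ioo
  have hmgf : ∀ t ∈ Set.Ioo (-ε) ε, mgf id P t = mgf id Q t := fun t ht ↦ by
    simp only [mgf, id]
    rw [integral_eq_lintegral_of_nonneg_ae (ae_of_all _ fun _ ↦ Real.exp_nonneg _) (by fun_prop),
      integral_eq_lintegral_of_nonneg_ae (ae_of_all _ fun _ ↦ Real.exp_nonneg _) (by fun_prop),
      h t ht]
  have hstrip : Set.EqOn (complexMGF id P) (complexMGF id Q) {z | z.re ∈ Set.Ioo (-ε) ε} := by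
    refine AnalyticOnNhd.eqOn_of_preconnected_of_frequently_eq
      (analyticOnNhd_complexMGF.mono fun z hz ↦ subset_P hz)
      (analyticOnNhd_complexMGF.mono fun z hz ↦ subset_Q hz)
      ((convex_Ioo (-ε) ε).linear_preimage Complex.reLm).isPreconnected
      (z₀ := ((0 : ℝ) : ℂ)) (by simpa using hε) ?_
    have hreal : ∃ᶠ x : ℝ in nhdsWithin 0 {0}ᶜ, complexMGF id P x = complexMGF id Q x := by
      refine Filter.Eventually.frequently ?_
      filter_upwards [nhdsWithin_le_nhds (Ioo_mem_nhds (neg_lt_zero.2 hε) hε)] with x hx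
      rw [complexMGF_ofReal, complexMGF_ofReal, hmgf x hx]
    refine Filter.Tendsto.frequently ?_ hreal
    exact Complex.continuous_ofReal.continuousWithinAt.tendsto_nhdsWithin
      fun x hx ↦ by simpa using hx
  refine Measure.ext_of_charFun (funext fun t ↦ ?_)
  rw [← complexMGF_id_mul_I, ← complexMGF_id_mul_I]
  exact hstrip (by simpa using hε)

namespace ProbabilityTheory

theorem gammaPDFReal_mul_exp {a r t : ℝ} (hr : 0 < r) (ht : t < r) (x : ℝ) :
    gammaPDFReal a r x * Real.exp (t * x) =
      (r / (r - t)) ^ a * gammaPDFReal a (r - t) x := by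
  have hrt : 0 < r - t := sub_pos.2 ht
  have hpow : (r - t) ^ a ≠ 0 := (Real.rpow_pos_of_pos hrt a).ne'
  unfold gammaPDFReal
  split_ifs
  · rw [Real.div_rpow hr.le hrt.le, mul_assoc, ← Real.exp_add,
      show -(r * x) + t * x = -((r - t) * x) by ring]
    field_simp
  · simp

theorem lintegral_exp_mul_gammaMeasure {a r t : ℝ} (ha : 0 < a) (hr : 0 < r) (ht : t < r) :
    ∫⁻ x, ENNReal.ofReal (Real.exp (t * x)) ∂(gammaMeasure a r) =
      ENNReal.ofReal ((r / (r - t)) ^ a) := by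
  have hrt : 0 < r - t := sub_pos.2 ht
  have hmeas (b : ℝ) : Measurable (gammaPDF a b) := (measurable_gammaPDFReal a b).ennreal_ofReal
  rw [gammaMeasure, lintegral_withDensity_eq_lintegral_mul _ (hmeas r) (by fun_prop)]
  calc ∫⁻ x, (gammaPDF a r * fun x ↦ ENNReal.ofReal (Real.exp (t * x))) x
      = ∫⁻ x, ENNReal.ofReal ((r / (r - t)) ^ a) * gammaPDF a (r - t) x := by
        refine lintegral_congr fun x ↦ ?_
        rw [Pi.mul_apply, gammaPDF, gammaPDF,
          ← ENNReal.ofReal_mul (gammaPDFReal_nonneg ha hr x), gammaPDFReal_mul_exp hr ht,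
          ENNReal.ofReal_mul (by positivity)]
    _ = ENNReal.ofReal ((r / (r - t)) ^ a) := by
        rw [lintegral_const_mul _ (hmeas _), lintegral_gammaPDF_eq_one ha hrt, mul_one]

theorem ae_nonneg_gammaMeasure (a r : ℝ) : ∀ᵐ x ∂(gammaMeasure a r), 0 ≤ x := by
  simp only [ae_iff, not_le]
  change gammaMeasure a r (Set.Iio 0) = 0
  rw [gammaMeasure, withDensity_apply _ measurableSet_Iio, lintegral_gammaPDF_of_nonpos le_rfl]

theorem lintegral_exp_mul_gaussianReal (m : ℝ) (v : NNReal) (t : ℝ) :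
    ∫⁻ x, ENNReal.ofReal (Real.exp (t * x)) ∂(gaussianReal m v) =
      ENNReal.ofReal (Real.exp (m * t + v * t ^ 2 / 2)) := by
  rw [← ofReal_integral_eq_lintegral_ofReal (integrable_exp_mul_gaussianReal t)
    (ae_of_all _ fun _ ↦ Real.exp_nonneg _)]
  exact congrArg ENNReal.ofReal (congrFun mgf_id_gaussianReal t)

/-- The moment generating function of a Gaussian variance-mean mixture over a Gamma law. -/
theorem lintegral_exp_mul_bind_gaussianReal {a r m v t : ℝ} (ha : 0 < a) (hr : 0 < r)
    (hv : 0 ≤ v) (ht : m * t + v * t ^ 2 / 2 < r) :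
    ∫⁻ x, ENNReal.ofReal (Real.exp (t * x)) ∂((gammaMeasure a r).bind
      (fun s ↦ gaussianReal (m * s) (Real.toNNReal (v * s)))) =
      ENNReal.ofReal ((r / (r - (m * t + v * t ^ 2 / 2))) ^ a) := by
  rw [Measure.lintegral_bind (by fun_prop) (by fun_prop),
    ← lintegral_exp_mul_gammaMeasure ha hr ht]
  refine lintegral_congr_ae ?_
  filter_upwards [ae_nonneg_gammaMeasure a r] with s hs
  rw [lintegral_exp_mul_gaussianReal, Real.coe_toNNReal _ (mul_nonneg hv hs)]
  ring_nf

end ProbabilityTheory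

theorem lintegral_exp_mul_bilateralGammaMeasure {ap lp am lm t : ℝ} (hap : 0 < ap)
    (hlp : 0 < lp) (ham : 0 < am) (hlm : 0 < lm) (htp : t < lp) (htm : -t < lm) :
    ∫⁻ x, ENNReal.ofReal (Real.exp (t * x)) ∂(bilateralGammaMeasure ap lp am lm) =
      ENNReal.ofReal ((lp / (lp - t)) ^ ap * (lm / (lm + t)) ^ am) := by
  have := isProbabilityMeasure_gammaMeasure hap hlp
  have := isProbabilityMeasure_gammaMeasure ham hlm
  have hp : 0 < lp - t := sub_pos.2 htp
  rw [bilateralGammaMeasure, lintegral_map (by fun_prop) (by fun_prop)]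
  simp_rw [show ∀ p : ℝ × ℝ, t * (p.1 - p.2) = t * p.1 + -t * p.2 from fun p ↦ by ring,
    Real.exp_add, ENNReal.ofReal_mul (Real.exp_nonneg _)]
  rw [lintegral_prod_mul (f := fun x ↦ ENNReal.ofReal (Real.exp (t * x)))
      (g := fun y ↦ ENNReal.ofReal (Real.exp (-t * y))) (by fun_prop) (by fun_prop),
    lintegral_exp_mul_gammaMeasure hap hlp htp, lintegral_exp_mul_gammaMeasure ham hlm htm,
    sub_neg_eq_add, ENNReal.ofReal_mul (by positivity)]

/-- with `μ = α/λ⁺ − α/λ⁻` and `σ² = 2α/(λ⁺λ⁻)`, the bilateral Gamma distribution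
`Γ(α,λ⁺;α,λ⁻)` is the Normal variance-mean mixture of the Gaussian kernel `s ↦ N(μs, σ²s)` over
the Gamma mixing law `Γ(α,α)`. -/
theorem bilateralGamma_is_normal_variance_mean_mixture (α lp lm μ σ2 : ℝ)
    (hα : 0 < α) (hlp : 0 < lp) (hlm : 0 < lm)
    (hμ : μ = α / lp - α / lm) (hσ2 : σ2 = 2 * α / (lp * lm)) :
    bilateralGammaMeasure α lp α lm
      = (gammaMeasure α α).bind (fun s => gaussianReal (μ * s) (Real.toNNReal (σ2 * s))) := by
  subst hμ hσ2
  have := isProbabilityMeasure_gammaMeasure hα hlp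
  have := isProbabilityMeasure_gammaMeasure hα hlm
  have := isProbabilityMeasure_gammaMeasure hα hα
  have : IsProbabilityMeasure (bilateralGammaMeasure α lp α lm) :=
    Measure.isProbabilityMeasure_map (by fun_prop)
  have : IsProbabilityMeasure ((gammaMeasure α α).bind (fun s ↦
      gaussianReal ((α / lp - α / lm) * s) (Real.toNNReal (2 * α / (lp * lm) * s)))) :=
    isProbabilityMeasure_bind (by fun_prop) (ae_of_all _ fun _ ↦ inferInstance)
  have hmgf (t : ℝ) (ht : t ∈ Set.Ioo (-min lp lm) (min lp lm)) :=
    lintegral_exp_mul_bilateralGammaMeasure (t := t) hα hlp hα hlm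
      (ht.2.trans_le (min_le_left _ _)) ((neg_lt.1 ht.1).trans_le (min_le_right _ _))
  refine Measure.ext_of_lintegral_exp_mul_eq (lt_min hlp hlm)
    (fun t ht ↦ hmgf t ht ▸ ENNReal.ofReal_ne_top) fun t ht ↦ ?_
  have hp : 0 < lp - t := sub_pos.2 (ht.2.trans_le (min_le_left _ _))
  have hm : 0 < lm + t := by linarith [(neg_lt.1 ht.1).trans_le (min_le_right lp lm)]
  have hfactor : α - ((α / lp - α / lm) * t + 2 * α / (lp * lm) * t ^ 2 / 2) =
      α * ((lp - t) * (lm + t)) / (lp * lm) := by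
    field_simp
    ring
  have hlt : (α / lp - α / lm) * t + 2 * α / (lp * lm) * t ^ 2 / 2 < α :=
    sub_pos.1 (hfactor ▸ by positivity)
  rw [hmgf t ht, lintegral_exp_mul_bind_gaussianReal hα hα (by positivity) hlt, hfactor,
    ← Real.mul_rpow (by positivity) (by positivity)]
  congr 2
  field_simp
end

section
/- Let α⁺, α⁻, λ⁻ > 0 and λ⁺ > λ⁻ + 2 (so that λ⁺ > 1 and the hypergeometric series below converge, since |−(λ⁻+1)/(λ⁺−1)| < 1 and |−λ⁻/λ⁺| < 1). Let Z ~ Γ(α⁺,λ⁺;α⁻,λ⁻) and let s, K > 0. Then E[(s e^{Z} − K)·1_{Z > 0}] = [(λ⁺)^{α⁺}(λ⁻)^{α⁻} Γ(α⁺+α⁻) / (Γ(α⁺) Γ(α⁻+1))] · ( s · ₂F₁(α⁺+α⁻, α⁻; α⁻+1; −(λ⁻+1)/(λ⁺−1)) / (λ⁺−1)^{α⁺+α⁻} − K · ₂F₁(α⁺+α⁻, α⁻; α⁻+1; −λ⁻/λ⁺) / (λ⁺)^{α⁺+α⁻} ). (This is the closed-form part of the European Call pricing formula, Π(s,K,α⁺,α⁻,λ⁺,λ⁻)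 minus its integral over (ln(K/s), 0].) -/
open MeasureTheory ProbabilityTheory

theorem choose_eq_ascPochhammer_eval (c : ℝ) (n : ℕ) :
    Ring.choose (c + n - 1) n = (n.factorial : ℝ)⁻¹ * (ascPochhammer ℝ n).eval c := by
  have h := Ring.factorial_nsmul_multichoose_eq_ascPochhammer c n
  rw [Polynomial.ascPochhammer_smeval_eq_eval, nsmul_eq_mul, Ring.multichoose_eq] at h
  rw [← h, inv_mul_cancel_left₀ (by positivity)]

theorem hasSum_one_sub_rpow_neg (c : ℝ) {x : ℝ} (hx : |x| < 1) :
    HasSum (fun n : ℕ => (n.factorial : ℝ)⁻¹ * (ascPochhammer ℝ n).eval c * x ^ n)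
      ((1 - x) ^ (-c)) := by
  have h := (Real.one_div_one_sub_rpow_hasFPowerSeriesOnBall_zero c).hasSum (y := x)
    (by simpa [enorm_eq_nnnorm] using! hx)
  have h1 : 0 ≤ 1 - x := by linarith [(abs_lt.1 hx).2]
  simpa [FormalMultilinearSeries.ofScalars_apply_eq, choose_eq_ascPochhammer_eval,
    Real.rpow_neg h1, -FormalMultilinearSeries.apply_eq_prod_smul_coeff] using h

theorem ascPochhammer_eval_mul_inv_eval_add_one {b : ℝ} (hb : 0 < b) (n : ℕ) :
    (ascPochhammer ℝ n).eval b * ((ascPochhammer ℝ n).eval (b + 1))⁻¹ = b / (b + n) := by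
  have h : (ascPochhammer ℝ n).eval b * (b + n) = b * (ascPochhammer ℝ n).eval (b + 1) := by
    rw [← ascPochhammer_succ_eval, ascPochhammer_succ_left]
    simp
  have h1 : 0 < (ascPochhammer ℝ n).eval (b + 1) := ascPochhammer_pos n _ (by positivity)
  have : 0 < b + n := by positivity
  field_simp
  linarith

theorem integrableOn_rpow_sub_one_add {b : ℝ} (hb : 0 < b) (n : ℕ) :
    IntegrableOn (fun u : ℝ => u ^ (b - 1 + n)) (Set.Ioo 0 1) :=
  (intervalIntegral.integrableOn_Ioo_rpow_iff one_pos).2 (by linarith [n.cast_nonneg (α := ℝ)])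

theorem integral_rpow_sub_one_add {b : ℝ} (hb : 0 < b) (n : ℕ) :
    ∫ u in Set.Ioo (0 : ℝ) 1, u ^ (b - 1 + n) = 1 / (b + n) := by
  have hn := n.cast_nonneg (α := ℝ)
  rw [← integral_Ioc_eq_integral_Ioo, ← intervalIntegral.integral_of_le zero_le_one,
    integral_rpow (Or.inl (by linarith)), Real.one_rpow,
    Real.zero_rpow (by linarith)]
  ring

/-- The Euler integral representation of `₂F₁ c b (b + 1) z`. -/
theorem integral_rpow_mul_one_sub_mul_rpow_neg (c : ℝ) {b z : ℝ} (hb : 0 < b) (hz : |z| < 1) :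
    ∫ u in Set.Ioo (0 : ℝ) 1, u ^ (b - 1) * (1 - z * u) ^ (-c) = ₂F₁ c b (b + 1) z / b := by
  set A : ℕ → ℝ := fun n => (n.factorial : ℝ)⁻¹ * (ascPochhammer ℝ n).eval c
  set F : ℕ → ℝ → ℝ := fun n u => A n * z ^ n * u ^ (b - 1 + n)
  have hF_int (n : ℕ) : IntegrableOn (F n) (Set.Ioo 0 1) :=
    (integrableOn_rpow_sub_one_add hb n).const_mul _
  have hF_norm (n : ℕ) : ∫ u in Set.Ioo (0 : ℝ) 1, ‖F n u‖ = ‖A n * z ^ n‖ * (1 / (b + n)) := by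
    rw [← integral_rpow_sub_one_add hb n, ← integral_const_mul]
    refine setIntegral_congr_fun measurableSet_Ioo fun u hu => ?_
    simp only [F]
    rw [norm_mul, Real.norm_of_nonneg (Real.rpow_nonneg hu.1.le _)]
  have hF_sum : Summable fun n => ∫ u in Set.Ioo (0 : ℝ) 1, ‖F n u‖ := by
    simp_rw [hF_norm]
    refine .of_nonneg_of_le (fun n => by positivity) (fun n => ?_)
      ((hasSum_one_sub_rpow_neg c hz).summable.norm.mul_right (1 / b))
    gcongr
    linarith [n.cast_nonneg (α := ℝ)]
  have hsum := integral_tsum_of_summable_integral_norm hF_int hF_sum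
  have hpt : ∫ u in Set.Ioo (0 : ℝ) 1, u ^ (b - 1) * (1 - z * u) ^ (-c) =
      ∫ u in Set.Ioo (0 : ℝ) 1, ∑' n, F n u := by
    refine setIntegral_congr_fun measurableSet_Ioo fun u hu => ?_
    have hzu : |z * u| < 1 := by
      rw [abs_mul, abs_of_pos hu.1]
      nlinarith [hu.1, hu.2, abs_nonneg z]
    refine (((hasSum_one_sub_rpow_neg c hzu).mul_left (u ^ (b - 1))).tsum_eq.symm).trans ?_
    refine tsum_congr fun n => ?_
    simp only [F, A]
    rw [Real.rpow_add hu.1, Real.rpow_natCast, mul_pow]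
    ring
  rw [hpt, ← hsum, ordinaryHypergeometric_eq_tsum, ← tsum_div_const]
  refine tsum_congr fun n => ?_
  simp only [F]
  rw [integral_const_mul, integral_rpow_sub_one_add hb, smul_eq_mul, mul_assoc _ _ (_)⁻¹,
    ascPochhammer_eval_mul_inv_eval_add_one hb]
  have : 0 < b + n := by positivity
  simp only [A]
  field_simp

theorem integrableOn_rpow_mul_one_sub_mul_rpow_neg {b c z : ℝ} (hb : 0 < b) (hc : 0 ≤ c)
    (hz : z ≤ 0) :
    IntegrableOn (fun u : ℝ => u ^ (b - 1) * (1 - z * u) ^ (-c)) (Set.Ioo 0 1) := by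
  have h0 : IntegrableOn (fun u : ℝ => u ^ (b - 1)) (Set.Ioo 0 1) := by
    simpa using integrableOn_rpow_sub_one_add hb 0
  refine Integrable.mono' h0 (by fun_prop) ?_
  refine (ae_restrict_iff' measurableSet_Ioo).2 (.of_forall fun u hu => ?_)
  have h1 : 1 ≤ 1 - z * u := by nlinarith [hu.1]
  rw [Real.norm_of_nonneg (mul_nonneg (Real.rpow_nonneg hu.1.le _) (by positivity))]
  exact mul_le_of_le_one_right (Real.rpow_nonneg hu.1.le _)
    (Real.rpow_le_one_of_one_le_of_nonpos h1 (by linarith))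

theorem lintegral_Ioo_zero_eq_mul_lintegral_Ioo_zero_one (f : ℝ → ENNReal) {x : ℝ} (hx : 0 < x) :
    ∫⁻ y in Set.Ioo 0 x, f y = ∫⁻ u in Set.Ioo (0 : ℝ) 1, ENNReal.ofReal x * f (x * u) := by
  have h := lintegral_image_eq_lintegral_abs_deriv_mul (s := Set.Ioo (0 : ℝ) 1)
    (f := fun u => x * u) (f' := fun _ => x) measurableSet_Ioo
    (fun u _ => by simpa using ((hasDerivAt_id u).const_mul x).hasDerivWithinAt)
    (mul_right_injective₀ hx.ne').injOn f
  rwa [Set.image_mul_left_Ioo hx, mul_zero, mul_one, abs_of_pos hx] at h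

theorem lintegral_rpow_mul_exp_neg_mul_Ioi {a r : ℝ} (ha : 0 < a) (hr : 0 < r) :
    ∫⁻ x in Set.Ioi (0 : ℝ), ENNReal.ofReal (x ^ (a - 1) * Real.exp (-(r * x))) =
      ENNReal.ofReal (r ^ (-a) * Real.Gamma a) := by
  have hint : IntegrableOn (fun x : ℝ => x ^ (a - 1) * Real.exp (-(r * x))) (Set.Ioi 0) := by
    simpa [neg_mul] using
      integrableOn_rpow_mul_exp_neg_mul_rpow (s := a - 1) (p := 1) (by linarith) one_pos hr
  rw [← ofReal_integral_eq_lintegral_ofReal hint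
    ((ae_restrict_iff' measurableSet_Ioi).2 (.of_forall fun x hx =>
      mul_nonneg (Real.rpow_nonneg (le_of_lt hx) _) (Real.exp_pos _).le)),
    Real.integral_rpow_mul_exp_neg_mul_Ioi ha hr, one_div, Real.inv_rpow hr.le, Real.rpow_neg hr.le]

theorem lintegral_Ioi_lintegral_Ioo_rpow_mul_exp {a b p q : ℝ} (ha : 0 < a) (hb : 0 < b)
    (hq : 0 ≤ q) (hqp : q < p) :
    ∫⁻ x in Set.Ioi (0 : ℝ), ∫⁻ y in Set.Ioo 0 x, ENNReal.ofReal
        (x ^ (a - 1) * Real.exp (-(p * x)) * (y ^ (b - 1) * Real.exp (-(q * y)))) =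
      ENNReal.ofReal
        (Real.Gamma (a + b) * (₂F₁ (a + b) b (b + 1) (-q / p) / b) / p ^ (a + b)) := by
  have hp : 0 < p := hq.trans_lt hqp
  have hz : |-q / p| < 1 := by
    rw [neg_div, abs_neg, abs_of_nonneg (by positivity), div_lt_one hp]
    exact hqp
  have hz0 : -q / p ≤ 0 := by
    rw [neg_div]
    exact neg_nonpos.2 (by positivity)
  have hscale : ∀ x ∈ Set.Ioi (0 : ℝ), ∫⁻ y in Set.Ioo 0 x, ENNReal.ofReal
        (x ^ (a - 1) * Real.exp (-(p * x)) * (y ^ (b - 1) * Real.exp (-(q * y)))) =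
      ∫⁻ u in Set.Ioo (0 : ℝ) 1, ENNReal.ofReal
        (u ^ (b - 1) * (x ^ (a + b - 1) * Real.exp (-((p + q * u) * x)))) := by
    intro x hx
    rw [lintegral_Ioo_zero_eq_mul_lintegral_Ioo_zero_one _ hx]
    refine setLIntegral_congr_fun measurableSet_Ioo fun u hu => ?_
    rw [← ENNReal.ofReal_mul (le_of_lt hx)]
    congr 1
    have h1 : x ^ (a + b - 1) = x * x ^ (a - 1) * x ^ (b - 1) := by
      rw [show a + b - 1 = 1 + (a - 1) + (b - 1) by ring, Real.rpow_add hx, Real.rpow_add hx,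
        Real.rpow_one]
    have h2 : Real.exp (-((p + q * u) * x)) = Real.exp (-(p * x)) * Real.exp (-(q * (x * u))) := by
      rw [← Real.exp_add]
      ring_nf
    rw [h1, h2, Real.mul_rpow (le_of_lt hx) hu.1.le]
    ring
  have hinner : ∀ u ∈ Set.Ioo (0 : ℝ) 1, ∫⁻ x in Set.Ioi (0 : ℝ), ENNReal.ofReal
        (u ^ (b - 1) * (x ^ (a + b - 1) * Real.exp (-((p + q * u) * x)))) =
      ENNReal.ofReal (Real.Gamma (a + b) / p ^ (a + b)) *
        ENNReal.ofReal (u ^ (b - 1) * (1 - -q / p * u) ^ (-(a + b))) := by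
    intro u hu
    have hu0 : 0 ≤ u := hu.1.le
    simp_rw [ENNReal.ofReal_mul (Real.rpow_nonneg hu0 (b - 1))]
    rw [lintegral_const_mul _ (by fun_prop),
      lintegral_rpow_mul_exp_neg_mul_Ioi (by positivity) (by positivity),
      show p + q * u = p * (1 - -q / p * u) by field_simp; ring,
      Real.mul_rpow hp.le (by nlinarith), Real.rpow_neg hp.le,
      mul_left_comm, ← ENNReal.ofReal_mul (p := Real.Gamma (a + b) / p ^ (a + b)) (by positivity)]
    congr 2
    ring
  rw [setLIntegral_congr_fun measurableSet_Ioi hscale, lintegral_lintegral_swap (by fun_prop),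
    setLIntegral_congr_fun measurableSet_Ioo hinner, lintegral_const_mul _ (by fun_prop),
    ← ofReal_integral_eq_lintegral_ofReal
      (integrableOn_rpow_mul_one_sub_mul_rpow_neg hb (by positivity) hz0)
      ((ae_restrict_iff' measurableSet_Ioo).2 (.of_forall fun u hu =>
        mul_nonneg (Real.rpow_nonneg hu.1.le _)
          (Real.rpow_nonneg (by nlinarith [hu.1]) _))),
    integral_rpow_mul_one_sub_mul_rpow_neg _ hb hz, ← ENNReal.ofReal_mul (by positivity)]
  congr 1
  ring

theorem ordinaryHypergeometric_add_one_nonneg {b c z : ℝ} (hb : 0 < b) (hz : |z| < 1) :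
    0 ≤ ₂F₁ c b (b + 1) z := by
  have h := integral_rpow_mul_one_sub_mul_rpow_neg c hb hz
  rw [eq_div_iff hb.ne'] at h
  rw [← h]
  refine mul_nonneg (setIntegral_nonneg measurableSet_Ioo fun u hu => ?_) hb.le
  refine mul_nonneg (Real.rpow_nonneg hu.1.le _) (Real.rpow_nonneg ?_ _)
  nlinarith [(abs_lt.1 hz).1, (abs_lt.1 hz).2, hu.1, hu.2]

/-- The partial exponential moment of the bilateral Gamma distribution on `(0, ∞)`. -/
theorem lintegral_Ioi_exp_mul_bilateralGammaMeasure {ap lp am lm t : ℝ} (hap : 0 < ap)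
    (ham : 0 < am) (hlp : 0 < lp) (hlm : 0 < lm) (ht : 0 ≤ lm + t) (htp : lm + t < lp - t) :
    ∫⁻ x in Set.Ioi (0 : ℝ), ENNReal.ofReal (Real.exp (t * x))
        ∂(bilateralGammaMeasure ap lp am lm) =
      ENNReal.ofReal (lp ^ ap * lm ^ am * Real.Gamma (ap + am) /
        (Real.Gamma ap * Real.Gamma (am + 1)) *
        (₂F₁ (ap + am) am (am + 1) (-(lm + t) / (lp - t)) / (lp - t) ^ (ap + am))) := by
  have hmeas (a r : ℝ) : Measurable (gammaPDF a r) := (measurable_gammaPDFReal a r).ennreal_ofReal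
  have hexp : Measurable ((Set.Ioi (0 : ℝ)).indicator
      fun x => ENNReal.ofReal (Real.exp (t * x))) :=
    Measurable.indicator (by fun_prop) measurableSet_Ioi
  have hsub : Measurable fun w : ℝ × ℝ => w.1 - w.2 := by fun_prop
  set C : ℝ := lp ^ ap / Real.Gamma ap * (lm ^ am / Real.Gamma am) with hC
  have hC0 : 0 ≤ C := by positivity
  have hpt (x : ℝ) : ∫⁻ y, gammaPDF ap lp x * gammaPDF am lm y * (Set.Ioi (0 : ℝ)).indicator
        (fun x => ENNReal.ofReal (Real.exp (t * x))) (x - y) =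
      (Set.Ioi (0 : ℝ)).indicator (fun x => ENNReal.ofReal C * ∫⁻ y in Set.Ioo 0 x, ENNReal.ofReal
        (x ^ (ap - 1) * Real.exp (-((lp - t) * x)) *
          (y ^ (am - 1) * Real.exp (-((lm + t) * y))))) x := by
    by_cases hx : 0 < x
    · rw [Set.indicator_of_mem (Set.mem_Ioi.2 hx), ← lintegral_const_mul _ (by fun_prop),
        ← lintegral_indicator measurableSet_Ioo]
      refine lintegral_congr_ae ?_
      filter_upwards [Measure.ae_ne volume (0 : ℝ)] with y hy
      rcases hy.lt_or_gt with hy | hy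
      · rw [gammaPDF_of_neg hy,
          Set.indicator_of_notMem (show y ∉ Set.Ioo 0 x from fun h => hy.not_gt h.1)]
        simp
      by_cases hyx : y < x
      · rw [Set.indicator_of_mem (Set.mem_Ioi.2 (sub_pos.2 hyx)),
          Set.indicator_of_mem (Set.mem_Ioo.2 ⟨hy, hyx⟩), gammaPDF_of_nonneg hx.le,
          gammaPDF_of_nonneg hy.le, ← ENNReal.ofReal_mul (by positivity),
          ← ENNReal.ofReal_mul (by positivity), ← ENNReal.ofReal_mul hC0]
        congr 1
        have h1 : Real.exp (-((lp - t) * x)) * Real.exp (-((lm + t) * y)) =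
            Real.exp (-(lp * x)) * Real.exp (-(lm * y)) * Real.exp (t * (x - y)) := by
          simp only [← Real.exp_add]
          ring_nf
        linear_combination -(C * x ^ (ap - 1) * y ^ (am - 1)) * h1
      · rw [Set.indicator_of_notMem
          (show x - y ∉ Set.Ioi 0 from fun h => hyx (sub_pos.1 h)),
          Set.indicator_of_notMem (show y ∉ Set.Ioo 0 x from fun h => hyx h.2), mul_zero]
    · rw [Set.indicator_of_notMem (show x ∉ Set.Ioi 0 from hx)]
      refine (lintegral_congr fun y => ?_).trans lintegral_zero
      by_cases hyx : y < x
      · rw [gammaPDF_of_neg (hyx.trans_le (not_lt.1 hx))]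
        simp
      · rw [Set.indicator_of_notMem
          (show x - y ∉ Set.Ioi 0 from fun h => hyx (sub_pos.1 h)), mul_zero]
  have hpt' (x y : ℝ) : ((fun w : ℝ × ℝ => gammaPDF ap lp w.1 * gammaPDF am lm w.2) *
      fun w : ℝ × ℝ => (Set.Ioi (0 : ℝ)).indicator
        (fun x => ENNReal.ofReal (Real.exp (t * x))) (w.1 - w.2)) (x, y) =
      gammaPDF ap lp x * gammaPDF am lm y * (Set.Ioi (0 : ℝ)).indicator
        (fun x => ENNReal.ofReal (Real.exp (t * x))) (x - y) := rfl
  have hcomp : Measurable fun w : ℝ × ℝ => (Set.Ioi (0 : ℝ)).indicator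
      (fun x => ENNReal.ofReal (Real.exp (t * x))) (w.1 - w.2) := hexp.comp hsub
  have hdens : Measurable fun w : ℝ × ℝ => gammaPDF ap lp w.1 * gammaPDF am lm w.2 :=
    ((hmeas ap lp).comp measurable_fst).mul ((hmeas am lm).comp measurable_snd)
  rw [← lintegral_indicator measurableSet_Ioi, bilateralGammaMeasure, lintegral_map hexp hsub,
    gammaMeasure, gammaMeasure, prod_withDensity (hmeas ap lp) (hmeas am lm),
    lintegral_withDensity_eq_lintegral_mul _ hdens hcomp,
    lintegral_prod _ (hdens.mul hcomp).aemeasurable]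
  simp_rw [hpt', hpt]
  rw [lintegral_indicator measurableSet_Ioi, lintegral_const_mul' _ _ ENNReal.ofReal_ne_top,
    lintegral_Ioi_lintegral_Ioo_rpow_mul_exp hap ham ht htp, ← ENNReal.ofReal_mul hC0, hC,
    Real.Gamma_add_one ham.ne']
  congr 1
  ring

/-- Integrability on `(0, ∞)` and value of the partial exponential moment of the bilateral Gamma
distribution. -/
theorem integral_Ioi_exp_mul_bilateralGammaMeasure {ap lp am lm t : ℝ} (hap : 0 < ap)
    (ham : 0 < am) (hlp : 0 < lp) (hlm : 0 < lm) (ht : 0 ≤ lm + t) (htp : lm + t < lp - t) :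
    IntegrableOn (fun x => Real.exp (t * x)) (Set.Ioi 0) (bilateralGammaMeasure ap lp am lm) ∧
    ∫ x in Set.Ioi (0 : ℝ), Real.exp (t * x) ∂(bilateralGammaMeasure ap lp am lm) =
      lp ^ ap * lm ^ am * Real.Gamma (ap + am) / (Real.Gamma ap * Real.Gamma (am + 1)) *
        (₂F₁ (ap + am) am (am + 1) (-(lm + t) / (lp - t)) / (lp - t) ^ (ap + am)) := by
  have h := lintegral_Ioi_exp_mul_bilateralGammaMeasure hap ham hlp hlm ht htp
  have hnn : 0 ≤ᵐ[(bilateralGammaMeasure ap lp am lm).restrict (Set.Ioi 0)]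
      fun x => Real.exp (t * x) := .of_forall fun x => (Real.exp_pos _).le
  have hlpt : 0 < lp - t := ht.trans_lt htp
  have hz : |-(lm + t) / (lp - t)| < 1 := by
    rw [neg_div, abs_neg, abs_of_nonneg (by positivity), div_lt_one hlpt]
    exact htp
  have hF := ordinaryHypergeometric_add_one_nonneg (c := ap + am) ham hz
  refine ⟨⟨by fun_prop, ?_⟩, ?_⟩
  · rw [hasFiniteIntegral_iff_ofReal hnn, h]
    exact ENNReal.ofReal_lt_top
  · rw [integral_eq_lintegral_of_nonneg_ae hnn (by fun_prop), h, ENNReal.toReal_ofReal]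
    positivity

/-- for `Z ~ Γ(α⁺,λ⁺;α⁻,λ⁻)` with `λ⁺ > λ⁻ + 2` and `s, K > 0`,
`E[(s e^Z − K)·1_{Z>0}]
  = (λ⁺)^{α⁺}(λ⁻)^{α⁻}Γ(α⁺+α⁻)/(Γ(α⁺)Γ(α⁻+1))
    ( s ₂F₁(α⁺+α⁻,α⁻;α⁻+1;−(λ⁻+1)/(λ⁺−1))/(λ⁺−1)^{α⁺+α⁻}
      − K ₂F₁(α⁺+α⁻,α⁻;α⁻+1;−λ⁻/λ⁺)/(λ⁺)^{α⁺+α⁻} )`,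
the closed-form part of the European Call pricing formula. -/
theorem bilateralGamma_call_price_closed_part (ap am lp lm s K : ℝ)
    (hap : 0 < ap) (ham : 0 < am) (hlm : 0 < lm) (hlp : lm + 2 < lp)
    (hs : 0 < s) (hK : 0 < K) :
    ∫ x in Set.Ioi (0 : ℝ), (s * Real.exp x - K) ∂(bilateralGammaMeasure ap lp am lm)
      = lp ^ ap * lm ^ am * Real.Gamma (ap + am) / (Real.Gamma ap * Real.Gamma (am + 1))
        * (s * ₂F₁ (ap + am) am (am + 1) (-(lm + 1) / (lp - 1)) / (lp - 1) ^ (ap + am)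
            - K * ₂F₁ (ap + am) am (am + 1) (-lm / lp) / lp ^ (ap + am)) := by
  obtain ⟨hi1, h1⟩ := integral_Ioi_exp_mul_bilateralGammaMeasure (t := 1) hap ham
    (by linarith : 0 < lp) hlm (by linarith) (by linarith)
  obtain ⟨hi0, h0⟩ := integral_Ioi_exp_mul_bilateralGammaMeasure (t := 0) hap ham
    (by linarith : 0 < lp) hlm (by linarith) (by linarith)
  simp only [one_mul] at hi1 h1
  simp only [zero_mul, Real.exp_zero, add_zero, sub_zero] at hi0 h0
  have hK' : ∫ _ in Set.Ioi (0 : ℝ), K ∂(bilateralGammaMeasure ap lp am lm) =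
      K * ∫ _ in Set.Ioi (0 : ℝ), (1 : ℝ) ∂(bilateralGammaMeasure ap lp am lm) := by
    rw [← integral_const_mul, mul_one]
  rw [integral_sub (hi1.const_mul s) (by simpa using hi0.const_mul K), integral_const_mul, hK',
    h1, h0]
  ring
end
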